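/- arXiv:1804.09393 — 4 statements merged into one kernel-verified Lean document; each statement's English description precedes it below -/
import Mathlib

section
/- If μ(t+2) = μ(t) for some natural number t, then μ(t+i) = μ(t) for every natural number i ≥ 0. -/
open scoped Classical

/-- The degree of a vertex `v` under an edge-weight assignment `x`:
the sum of the weights of the edges of `G` incident to `v`. -/
noncomputable def bmDeg {V : Type*} [Fintype V] (G : SimpleGraph V)
    (x : Sym2 V → ℕ) (v : V) : ℕ :=
  ∑ e ∈ Finset.univ.filter (fun e : Sym2 V => e ∈ G.edgeSet ∧ v ∈ e), x e

/-- The cardinality `‖x‖₁` of an edge-weight assignment `x`. -/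
noncomputable def bmCard {V : Type*} [Fintype V] (G : SimpleGraph V)
    (x : Sym2 V → ℕ) : ℕ :=
  ∑ e ∈ Finset.univ.filter (fun e : Sym2 V => e ∈ G.edgeSet), x e

/-- `x` is a `b`-matching of `(G, b)`: it is supported on the edges of `G`
and the degree of every vertex `v` is at most `b v`. -/
def IsBMatching {V : Type*} [Fintype V] (G : SimpleGraph V) (b : V → ℕ)
    (x : Sym2 V → ℕ) : Prop :=
  (∀ e, e ∉ G.edgeSet → x e = 0) ∧ ∀ v, bmDeg G x v ≤ b v

/-- The maximum cardinality of a `b`-matching of `(G, b)`. -/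
noncomputable def maxBM {V : Type*} [Fintype V] (G : SimpleGraph V) (b : V → ℕ) : ℕ :=
  sSup {m | ∃ x, IsBMatching G b x ∧ bmCard G x = m}

/-- `mu G b w t` : the maximum cardinality of a `b`-matching of `G` when the
capacity of `w` is set to `t` and every other vertex `v` has capacity `b v`. -/
noncomputable def mu {V : Type*} [Fintype V] (G : SimpleGraph V) (b : V → ℕ)
    (w : V) (t : ℕ) : ℕ :=
  maxBM G (Function.update b w t)


section aux
variable {V : Type*} [Fintype V]

theorem bm_deg_add (G : SimpleGraph V) (y : Sym2 V → ℕ) (e : Sym2 V) (he : e ∈ G.edgeSet) (v : V) :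
    bmDeg G (y + Pi.single e 1) v = bmDeg G y v + if v ∈ e then 1 else 0 := by
  unfold bmDeg
  simp only [Pi.add_apply, Finset.sum_add_distrib]
  congr 1
  simp only [Pi.single_apply, Finset.sum_ite_eq']
  simp [he]

theorem bm_card_add (G : SimpleGraph V) (y : Sym2 V → ℕ) (e : Sym2 V) (he : e ∈ G.edgeSet) :
    bmCard G (y + Pi.single e 1) = bmCard G y + 1 := by
  unfold bmCard
  simp only [Pi.add_apply, Finset.sum_add_distrib]
  congr 1
  simp only [Pi.single_apply, Finset.sum_ite_eq']
  simp [he]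

theorem bm_sub_add (y : Sym2 V → ℕ) (e : Sym2 V) (h : 0 < y e) :
    (y - Pi.single e 1) + Pi.single e 1 = y := by
  funext f
  by_cases hf : f = e
  · subst hf; simp; omega
  · simp [hf]

theorem bm_handshake (G : SimpleGraph V) (x : Sym2 V → ℕ) :
    ∑ v, bmDeg G x v = 2 * bmCard G x := by
  unfold bmDeg bmCard
  simp only [Finset.sum_filter]
  rw [Finset.sum_comm, Finset.mul_sum]
  refine Finset.sum_congr rfl fun e _ => ?_
  by_cases he : e ∈ G.edgeSet
  · simp only [he, true_and, if_true]
    rw [← Finset.sum_filter, Finset.sum_const, smul_eq_mul]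
    congr 1
    rw [← Sym2.card_toFinset_of_not_isDiag e (G.not_isDiag_of_mem_edgeSet he)]
    congr 1
    ext v
    simp
  · simp [he]

/-- The L1 distance between two weight assignments. -/
noncomputable def bmDist (x y : Sym2 V → ℕ) : ℕ := ∑ e, ((x e - y e) + (y e - x e))

theorem bm_dist_add (x y : Sym2 V → ℕ) (e : Sym2 V) (h : y e < x e) :
    bmDist x (y + Pi.single e 1) < bmDist x y := by
  unfold bmDist
  apply Finset.sum_lt_sum
  · intro f _
    by_cases hf : f = e
    · subst hf; simp; omega
    · simp [hf]
  · exact ⟨e, Finset.mem_univ _, by simp; omega⟩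

theorem bm_dist_sub (x y : Sym2 V → ℕ) (e : Sym2 V) (h : x e < y e) :
    bmDist x (y - Pi.single e 1) < bmDist x y := by
  unfold bmDist
  apply Finset.sum_lt_sum
  · intro f _
    by_cases hf : f = e
    · subst hf; simp; omega
    · simp [hf]
  · exact ⟨e, Finset.mem_univ _, by simp; omega⟩

theorem bm_core (G : SimpleGraph V) (b : V → ℕ) (w : V) (x : Sym2 V → ℕ)
    (hx : ∀ v, v ≠ w → bmDeg G x v ≤ b v) (n : ℕ) :
    ∀ y : Sym2 V → ℕ, bmDist x y = n → (∀ e, e ∉ G.edgeSet → y e = 0) →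
    (∀ v, v ≠ w → bmDeg G y v ≤ b v) → bmCard G x < bmCard G y →
    ∃ z : Sym2 V → ℕ, (∀ e, e ∉ G.edgeSet → z e = 0) ∧
      (∀ v, v ≠ w → bmDeg G z v ≤ b v) ∧ bmCard G x < bmCard G z ∧
      bmDeg G z w ≤ bmDeg G x w + 2 := by
  induction n using Nat.strong_induction_on with
  | _ n ih =>
  intro y hn hs hb hc
  by_cases hw : bmDeg G y w ≤ bmDeg G x w + 2
  · exact ⟨y, hs, hb, hc, hw⟩
  push Not at hw
  by_cases hc2 : bmCard G x + 1 < bmCard G y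
  · obtain ⟨e, he, hlt⟩ := Finset.exists_lt_of_sum_lt hc
    have he : e ∈ G.edgeSet := by simpa using he
    have hy := bm_sub_add y e (by omega)
    have h1 := bm_card_add G (y - Pi.single e 1) e he
    rw [hy] at h1
    refine ih _ (hn ▸ bm_dist_sub x y e hlt) _ rfl ?_ ?_ (by omega)
    · intro f hf
      simp [hs f hf]
    · intro v hv
      have h2 := bm_deg_add G (y - Pi.single e 1) e he v
      rw [hy] at h2
      have := hb v hv
      omega
  have hsum : ∃ v, bmDeg G y v < bmDeg G x v := by
    by_contra hno
    push Not at hno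
    have h1 := bm_handshake G x
    have h2 := bm_handshake G y
    rw [← Finset.add_sum_erase _ _ (Finset.mem_univ w)] at h1 h2
    have h3 := Finset.sum_le_sum (s := Finset.univ.erase w) (fun v _ => hno v)
    omega
  obtain ⟨v, hv⟩ := hsum
  have hvw : v ≠ w := by rintro rfl; omega
  obtain ⟨e, he, hlt⟩ := Finset.exists_lt_of_sum_lt hv
  obtain ⟨he, hve⟩ : e ∈ G.edgeSet ∧ v ∈ e := by simpa using he
  obtain ⟨u, rfl⟩ := Sym2.mem_iff_exists.1 hve
  have huv : v ≠ u := G.ne_of_adj he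
  set y1 := y + Pi.single s(v, u) 1 with hy1
  have hd1 : bmDist x y1 < n := hn ▸ bm_dist_add x y _ hlt
  have hc1 : bmCard G y1 = bmCard G y + 1 := bm_card_add G y _ he
  have hdeg := bm_deg_add G y _ he
  rw [← hy1] at hdeg
  have hs1 : ∀ f, f ∉ G.edgeSet → y1 f = 0 := by
    intro f hf
    have : f ≠ s(v, u) := by rintro rfl; exact hf he
    simp [hy1, hs f hf, this]
  have hb1 : ∀ a, a ≠ w → a ≠ u → bmDeg G y1 a ≤ b a := by
    intro a haw hau
    rw [hdeg]
    by_cases hav : a = v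
    · subst hav
      have := hx a haw
      simp; omega
    · simpa [hav, hau] using hb a haw
  by_cases hu : u = w ∨ bmDeg G y u < b u
  · refine ih _ hd1 _ rfl hs1 ?_ (by omega)
    intro a haw
    by_cases hau : a = u
    · subst hau
      rw [hdeg]
      simp
      rcases hu with hu | hu
      · exact absurd hu haw
      · omega
    · exact hb1 a haw hau
  push Not at hu
  obtain ⟨huw, hub⟩ := hu
  have hex : ∃ f, f ∈ G.edgeSet ∧ u ∈ f ∧ x f < y f := by
    by_contra hno
    push Not at hno
    have : bmDeg G y u < bmDeg G x u := by
      unfold bmDeg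
      apply Finset.sum_lt_sum
      · intro f hf
        have hf' := (Finset.mem_filter.1 hf).2
        exact hno f hf'.1 hf'.2
      · exact ⟨s(v, u), by simpa using he, hlt⟩
    have := hx u huw
    omega
  obtain ⟨f, hf, huf, hxf⟩ := hex
  have hfe : f ≠ s(v, u) := by rintro rfl; omega
  have hy1f : y1 f = y f := by simp [hy1, hfe]
  have hy2 := bm_sub_add y1 f (by omega)
  have hc2' := bm_card_add G (y1 - Pi.single f 1) f hf
  have hdeg2 := bm_deg_add G (y1 - Pi.single f 1) f hf
  rw [hy2] at hc2' hdeg2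
  refine ih _ ((bm_dist_sub x y1 f (by omega)).trans hd1) _ rfl ?_ ?_ (by omega)
  · intro g hg
    simp [hs1 g hg]
  · intro a haw
    have h2 := hdeg2 a
    by_cases hau : a = u
    · subst hau
      have h3 := hdeg a
      simp [huf] at h2 h3
      have := hb a haw
      omega
    · have := hb1 a haw hau
      omega

theorem bm_bdd (G : SimpleGraph V) (b : V → ℕ) :
    BddAbove {m | ∃ x, IsBMatching G b x ∧ bmCard G x = m} := by
  refine ⟨∑ v, b v, ?_⟩
  rintro m ⟨x, hx, rfl⟩
  have h1 := bm_handshake G x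
  have h2 := Finset.sum_le_sum (s := Finset.univ) (fun v _ => hx.2 v)
  omega

theorem bm_attain (G : SimpleGraph V) (b : V → ℕ) :
    ∃ x, IsBMatching G b x ∧ bmCard G x = maxBM G b := by
  have := Nat.sSup_mem (s := {m | ∃ x, IsBMatching G b x ∧ bmCard G x = m})
    ⟨0, fun _ => 0, ⟨fun _ _ => rfl, fun v => by simp [bmDeg]⟩, by simp [bmCard]⟩ (bm_bdd G b)
  exact this

theorem bm_le (G : SimpleGraph V) (b : V → ℕ) (x : Sym2 V → ℕ) (hx : IsBMatching G b x) :
    bmCard G x ≤ maxBM G b := le_csSup (bm_bdd G b) ⟨x, hx, rfl⟩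

end aux

/-- If `μ(t+2) = μ(t)` then `μ(t+i) = μ(t)` for every `i ≥ 0`. -/
theorem mu_constant_after_two {V : Type*} [Fintype V] (G : SimpleGraph V) (b : V → ℕ)
    (w : V) (t : ℕ) (h : mu G b w (t + 2) = mu G b w t) :
    ∀ i : ℕ, mu G b w (t + i) = mu G b w t := by
  intro i
  obtain ⟨x, hx, hxc⟩ := bm_attain G (Function.update b w t)
  obtain ⟨y, hy, hyc⟩ := bm_attain G (Function.update b w (t + i))
  have hxw := hx.2 w
  have hxb : ∀ v, v ≠ w → bmDeg G x v ≤ b v := fun v hv => by simpa [hv] using hx.2 v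
  have hyb : ∀ v, v ≠ w → bmDeg G y v ≤ b v := fun v hv => by simpa [hv] using hy.2 v
  simp only [Function.update_self] at hxw
  unfold mu at h ⊢
  have hle : maxBM G (Function.update b w t) ≤ maxBM G (Function.update b w (t + i)) := by
    rw [← hxc]
    refine bm_le _ _ _ ⟨hx.1, fun v => ?_⟩
    by_cases hv : v = w
    · subst hv; simp; omega
    · simpa [hv] using hxb v hv
  by_contra hne
  obtain ⟨z, hz0, hzb, hzc, hzw⟩ := bm_core G b w x hxb _ y rfl hy.1 hyb (by omega)
  have := bm_le G (Function.update b w (t + 2)) z ⟨hz0, fun v => by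
    by_cases hv : v = w
    · subst hv; simp; omega
    · simpa [hv] using hzb v hv⟩
  omega
end

section
/- There exist natural numbers c₁ and c₂ such that for every natural number t: μ(t) = μ(0) + t if t ≤ c₁; μ(t) = μ(0) + c₁ + ⌊(t − c₁)/2⌋ if c₁ < t ≤ c₁ + 2c₂; and μ(t) = μ(0) + c₁ + c₂ if t > c₁ + 2c₂. -/
open scoped Classical

/-- Signed degree. -/
noncomputable def zDeg {V : Type*} [Fintype V] (G : SimpleGraph V)
    (z : Sym2 V → ℤ) (v : V) : ℤ :=
  ∑ e ∈ Finset.univ.filter (fun e : Sym2 V => e ∈ G.edgeSet ∧ v ∈ e), z e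

/-- Signed cardinality. -/
noncomputable def zCard {V : Type*} [Fintype V] (G : SimpleGraph V)
    (z : Sym2 V → ℤ) : ℤ :=
  ∑ e ∈ Finset.univ.filter (fun e : Sym2 V => e ∈ G.edgeSet), z e

/-- `p` lies between `0` and `z`. -/
def Sand {V : Type*} (z p : Sym2 V → ℤ) : Prop :=
  ∀ e, (0 ≤ p e ∧ p e ≤ z e) ∨ (z e ≤ p e ∧ p e ≤ 0)

/-- Kronecker delta. -/
noncomputable def kd {V : Type*} (u x : V) : ℤ := if u = x then 1 else 0

section helpers
variable {V : Type*} [Fintype V] (G : SimpleGraph V)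

theorem zDeg_add (z p : Sym2 V → ℤ) (v : V) : zDeg G (z + p) v = zDeg G z v + zDeg G p v := by
  simp [zDeg, Finset.sum_add_distrib]

theorem zDeg_sub (z p : Sym2 V → ℤ) (v : V) : zDeg G (z - p) v = zDeg G z v - zDeg G p v := by
  simp [zDeg, Finset.sum_sub_distrib]

theorem zCard_add (z p : Sym2 V → ℤ) : zCard G (z + p) = zCard G z + zCard G p := by
  simp [zCard, Finset.sum_add_distrib]

theorem zCard_sub (z p : Sym2 V → ℤ) : zCard G (z - p) = zCard G z - zCard G p := by
  simp [zCard, Finset.sum_sub_distrib]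

theorem zDeg_single {a c : V} (h : G.Adj a c) (x : V) :
    zDeg G (Pi.single s(a, c) 1) x = kd a x + kd c x := by
  have hne := h.ne
  unfold zDeg kd
  rw [Finset.sum_filter, Finset.sum_eq_single s(a, c)]
  · by_cases h1 : a = x
    · subst h1; simp [h, hne.symm]
    · by_cases h2 : c = x
      · subst h2; simp [h, h1]
      · simp [h1, h2, Ne.symm h1, Ne.symm h2, eq_comm]
  · intro e _ he
    simp [he]
  · simp

theorem zCard_single {a c : V} (h : G.Adj a c) :
    zCard G (Pi.single s(a, c) 1) = 1 := by
  unfold zCard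
  rw [Finset.sum_filter, Finset.sum_eq_single s(a, c)]
  · simp [h]
  · intro e _ he
    simp [he]
  · simp

theorem handshake (z : Sym2 V → ℤ) : ∑ v, zDeg G z v = 2 * zCard G z := by
  unfold zDeg zCard
  simp_rw [Finset.sum_filter]
  rw [Finset.sum_comm, Finset.mul_sum]
  refine Finset.sum_congr rfl fun e _ => ?_
  induction e using Sym2.ind with
  | _ a c =>
    by_cases h : G.Adj a c
    · have : ∀ v, (if s(a, c) ∈ G.edgeSet ∧ v ∈ s(a, c) then z s(a, c) else 0)
          = (if v = a then z s(a, c) else 0) + (if v = c then z s(a, c) else 0) := by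
        intro v
        have hne := h.ne
        by_cases h1 : v = a
        · subst h1; simp [h, hne]
        · by_cases h2 : v = c
          · subst h2; simp [h, h1]
          · simp [h1, h2]
      rw [Finset.sum_congr rfl fun v _ => this v]
      simp [Finset.sum_add_distrib, h]
      ring
    · simp [h]

theorem exists_pos_edge {r : Sym2 V → ℤ} {v : V} (h : 0 < zDeg G r v) :
    ∃ c, G.Adj v c ∧ 0 < r s(v, c) := by
  obtain ⟨e, he, hpos⟩ := Finset.exists_lt_of_sum_lt
    (s := Finset.univ.filter (fun e : Sym2 V => e ∈ G.edgeSet ∧ v ∈ e)) (f := fun _ => (0:ℤ))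
    (g := r) (by simpa [zDeg] using h)
  simp only [Finset.mem_filter, Finset.mem_univ, true_and] at he
  obtain ⟨hG, c, rfl⟩ := he
  exact ⟨c, hG, hpos⟩

theorem exists_neg_edge {r : Sym2 V → ℤ} {v : V} (h : zDeg G r v < 0) :
    ∃ c, G.Adj v c ∧ r s(v, c) < 0 := by
  obtain ⟨e, he, hpos⟩ := Finset.exists_lt_of_sum_lt
    (s := Finset.univ.filter (fun e : Sym2 V => e ∈ G.edgeSet ∧ v ∈ e)) (g := fun _ => (0:ℤ))
    (f := r) (by simpa [zDeg] using h)
  simp only [Finset.mem_filter, Finset.mem_univ, true_and] at he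
  obtain ⟨hG, c, rfl⟩ := he
  exact ⟨c, hG, hpos⟩

theorem Sand.add_single {z p : Sym2 V → ℤ} (h : Sand z p) {e : Sym2 V} (he : 0 < (z - p) e) :
    Sand z (p + Pi.single e 1) := by
  intro f
  have := h f
  by_cases hf : f = e
  · subst hf
    simp at he ⊢
    omega
  · simp [hf]; omega

theorem Sand.sub_single {z p : Sym2 V → ℤ} (h : Sand z p) {e : Sym2 V} (he : (z - p) e < 0) :
    Sand z (p - Pi.single e 1) := by
  intro f
  have := h f
  by_cases hf : f = e
  · subst hf
    simp at he ⊢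
    omega
  · simp [hf]; omega

/-- l1 norm -/
noncomputable def l1 (z : Sym2 V → ℤ) : ℕ := ∑ e, (z e).natAbs

theorem l1_add {z p : Sym2 V → ℤ} {e : Sym2 V} (he : 0 < (z - p) e) :
    l1 (z - (p + Pi.single e 1)) < l1 (z - p) := by
  refine Finset.sum_lt_sum (fun f _ => ?_) ⟨e, Finset.mem_univ _, ?_⟩
  · by_cases hf : f = e
    · subst hf
      simp at he ⊢
      omega
    · simp [hf]
  · simp at he ⊢
    omega

theorem l1_sub {z p : Sym2 V → ℤ} {e : Sym2 V} (he : (z - p) e < 0) :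
    l1 (z - (p - Pi.single e 1)) < l1 (z - p) := by
  refine Finset.sum_lt_sum (fun f _ => ?_) ⟨e, Finset.mem_univ _, ?_⟩
  · by_cases hf : f = e
    · subst hf
      simp at he ⊢
      omega
    · simp [hf]
  · simp at he ⊢
    omega

theorem l1_sand {z p : Sym2 V → ℤ} (h : Sand z p) (hp : p ≠ 0) : l1 (z - p) < l1 z := by
  obtain ⟨e, he⟩ := Function.ne_iff.mp hp
  refine Finset.sum_lt_sum (fun f _ => ?_) ⟨e, Finset.mem_univ _, ?_⟩
  · have := h f
    simp only [Pi.sub_apply]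
    omega
  · have := h e
    simp only [Pi.sub_apply, Pi.zero_apply] at he ⊢
    omega

theorem Sand.trans_sub {z p q : Sym2 V → ℤ} (h : Sand z p) (hq : Sand (z - p) q) : Sand z q := by
  intro e
  have h1 := h e
  have h2 := hq e
  simp only [Pi.sub_apply] at h2
  omega

/-- augmenting vector -/
def Good (z p : Sym2 V → ℤ) : Prop :=
  Sand z p ∧ zCard G p = 1 ∧ ∀ v, 0 ≤ zDeg G p v ∧ zDeg G p v ≤ max (zDeg G z v) 0

theorem inner (z : Sym2 V → ℤ) (u : V) (hu : 0 < zDeg G z u) (n : ℕ) :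
    ∀ p v, l1 (z - p) = n → Sand z p → zCard G p = 0 →
      (∀ x, zDeg G p x = kd u x - kd v x) →
      (∃ p, Good G z p) ∨ ∃ p v, u ≠ v ∧ Sand z p ∧ zCard G p = 0 ∧ zDeg G z v < 0 ∧
        ∀ x, zDeg G p x = kd u x - kd v x := by
  induction n using Nat.strong_induction_on with
  | _ n ih =>
  intro p v hn hS hC hD
  by_cases hv : zDeg G z v ≤ zDeg G p v
  · right
    have huv : u ≠ v := by
      rintro rfl
      have := hD u
      omega
    refine ⟨p, v, huv, hS, hC, ?_, hD⟩
    have := hD v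
    simp [kd, huv] at this
    omega
  · have h1 : 0 < zDeg G (z - p) v := by rw [zDeg_sub]; omega
    obtain ⟨c, hvc, hpos⟩ := exists_pos_edge G h1
    have hS1 := hS.add_single hpos
    have hl1 := l1_add hpos
    have hC1 : zCard G (p + Pi.single s(v, c) 1) = 1 := by
      rw [zCard_add, zCard_single G hvc, hC]; rfl
    have hD1 : ∀ x, zDeg G (p + Pi.single s(v, c) 1) x = kd u x + kd c x := by
      intro x; rw [zDeg_add, zDeg_single G hvc, hD]; ring
    set p1 := p + Pi.single s(v, c) 1
    by_cases hc : zDeg G p1 c ≤ zDeg G z c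
    · left
      refine ⟨p1, hS1, hC1, fun x => ?_⟩
      by_cases hxc : c = x
      · subst hxc
        refine ⟨?_, le_max_of_le_left hc⟩
        rw [hD1]; unfold kd; split_ifs <;> simp
      · rw [hD1]
        by_cases hxu : u = x
        · subst hxu
          simp [kd, hxc]; omega
        · simp [kd, hxc, hxu]
    · have h2 : zDeg G (z - p1) c < 0 := by rw [zDeg_sub]; omega
      obtain ⟨d, hcd, hneg⟩ := exists_neg_edge G h2
      refine ih _ ?_ (p1 - Pi.single s(c, d) 1) d rfl (hS1.sub_single hneg) ?_ ?_
      · have := l1_sub hneg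
        omega
      · rw [zCard_sub, zCard_single G hcd, hC1]; rfl
      · intro x; rw [zDeg_sub, zDeg_single G hcd, hD1]; ring

theorem exists_good (n : ℕ) : ∀ z : Sym2 V → ℤ, l1 z = n → 0 < zCard G z → ∃ p, Good G z p := by
  induction n using Nat.strong_induction_on with
  | _ n ih =>
  intro z hn hz
  have hs : ∑ v : V, (0:ℤ) < ∑ v, zDeg G z v := by
    rw [handshake]; simpa using hz
  obtain ⟨u, _, hu⟩ := Finset.exists_lt_of_sum_lt hs
  rcases inner G z u hu _ 0 u rfl (fun e => by simp; omega) (by simp [zCard])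
    (fun x => by simp [zDeg]) with h | ⟨p, v, huv, hS, hC, hv, hD⟩
  · exact h
  · have hp : p ≠ 0 := by
      rintro rfl
      have := hD u
      simp [zDeg, kd, huv.symm] at this
    obtain ⟨q, hq, hqC, hqD⟩ := ih _ (hn ▸ l1_sand hS hp) (z - p) rfl (by rw [zCard_sub]; omega)
    refine ⟨q, hS.trans_sub hq, hqC, fun x => ⟨(hqD x).1, (hqD x).2.trans ?_⟩⟩
    rw [zDeg_sub, hD]
    by_cases h1 : u = x
    · subst h1; simp [kd, huv.symm]; omega
    · by_cases h2 : v = x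
      · subst h2; simp [kd, huv]; omega
      · simp [kd, h1, h2]

theorem Good.deg_le_two {z p : Sym2 V → ℤ} (h : Good G z p) (v : V) : zDeg G p v ≤ 2 := by
  have h1 := handshake G p
  rw [h.2.1] at h1
  have := Finset.single_le_sum (f := fun v => zDeg G p v) (fun v _ => (h.2.2 v).1)
    (Finset.mem_univ v)
  omega

theorem zDeg_cast (x : Sym2 V → ℕ) (v : V) : zDeg G (fun e => (x e : ℤ)) v = bmDeg G x v := by
  simp [zDeg, bmDeg]

theorem zCard_cast (x : Sym2 V → ℕ) : zCard G (fun e => (x e : ℤ)) = bmCard G x := by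
  simp [zCard, bmCard]

/-- applying an augmenting vector -/
theorem apply_good {b : V → ℕ} {w : V} {t s r : ℕ} {x y : Sym2 V → ℕ}
    (hx : IsBMatching G (Function.update b w t) x) (hy : IsBMatching G (Function.update b w s) y)
    {p : Sym2 V → ℤ} (hp : Sand ((fun e => (y e : ℤ)) - (fun e => (x e : ℤ))) p)
    (hC : zCard G p = 1)
    (hD : ∀ v, zDeg G p v ≤ max ((bmDeg G y v : ℤ) - bmDeg G x v) 0)
    (hr : (bmDeg G x w : ℤ) + zDeg G p w ≤ r) :
    ∃ x', IsBMatching G (Function.update b w r) x' ∧ bmCard G x' = bmCard G x + 1 := by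
  have key : (fun e => (((x e + p e).toNat : ℕ) : ℤ)) = (fun e => (x e : ℤ)) + p := by
    funext e
    have := hp e
    simp only [Pi.sub_apply, Pi.add_apply] at this ⊢
    omega
  refine ⟨fun e => (x e + p e).toNat, ⟨fun e he => ?_, fun v => ?_⟩, ?_⟩
  · have := hp e
    have h1 := hx.1 e he
    have h2 := hy.1 e he
    simp only [Pi.sub_apply] at this ⊢
    omega
  · have h := zDeg_cast G (fun e => (x e + p e).toNat) v
    rw [key, zDeg_add, zDeg_cast] at h
    by_cases hv : v = w
    · subst hv
      rw [Function.update_self]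
      omega
    · have h1 := hx.2 v
      have h2 := hy.2 v
      have h3 := hD v
      rw [Function.update_of_ne hv] at *
      omega
  · have h := zCard_cast G (fun e => (x e + p e).toNat)
    rw [key, zCard_add, zCard_cast] at h
    omega

theorem bm_bound {b : V → ℕ} {w : V} {t : ℕ} {x : Sym2 V → ℕ}
    (hx : IsBMatching G (Function.update b w t) x) :
    bmCard G x ≤ ∑ v ∈ Finset.univ.erase w, b v := by
  have h1 := handshake G (fun e => (x e : ℤ))
  simp_rw [zDeg_cast, zCard_cast] at h1
  have h1' : ∑ v, bmDeg G x v = 2 * bmCard G x := by exact_mod_cast h1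
  rw [← Finset.add_sum_erase _ _ (Finset.mem_univ w)] at h1'
  have h2 : bmDeg G x w ≤ bmCard G x := by
    refine Finset.sum_le_sum_of_subset fun e => ?_
    simp; tauto
  have h3 : ∑ v ∈ Finset.univ.erase w, bmDeg G x v ≤ ∑ v ∈ Finset.univ.erase w, b v := by
    refine Finset.sum_le_sum fun v hv => ?_
    have := hx.2 v
    rwa [Function.update_of_ne (Finset.ne_of_mem_erase hv)] at this
  omega

theorem mu_le_of {b : V → ℕ} {w : V} {t : ℕ} {x : Sym2 V → ℕ}
    (hx : IsBMatching G (Function.update b w t) x) : bmCard G x ≤ mu G b w t :=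
  le_csSup ⟨_, by rintro _ ⟨y, hy, rfl⟩; exact bm_bound G hy⟩ ⟨x, hx, rfl⟩

theorem mu_attained (b : V → ℕ) (w : V) (t : ℕ) :
    ∃ x, IsBMatching G (Function.update b w t) x ∧ bmCard G x = mu G b w t := by
  refine Nat.sSup_mem (s := {m | ∃ x, IsBMatching G (Function.update b w t) x ∧ bmCard G x = m})
    ⟨0, 0, ⟨by simp, by simp [bmDeg]⟩, by simp [bmCard]⟩
    ⟨_, by rintro _ ⟨y, hy, rfl⟩; exact bm_bound G hy⟩

theorem mu_mono (b : V → ℕ) (w : V) (t : ℕ) : mu G b w t ≤ mu G b w (t + 1) := by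
  obtain ⟨x, hx, h⟩ := mu_attained G b w t
  rw [← h]
  refine mu_le_of G ⟨hx.1, fun v => (hx.2 v).trans ?_⟩
  by_cases hv : v = w
  · subst hv; simp
  · simp [hv]

theorem mu_aug1 (b : V → ℕ) (w : V) (t s : ℕ) (h : mu G b w t < mu G b w s) :
    mu G b w t + 1 ≤ mu G b w (t + 2) := by
  obtain ⟨x, hx, hxc⟩ := mu_attained G b w t
  obtain ⟨y, hy, hyc⟩ := mu_attained G b w s
  obtain ⟨p, hp⟩ := exists_good G _ ((fun e => (y e : ℤ)) - (fun e => (x e : ℤ))) rfl (by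
    rw [zCard_sub, zCard_cast, zCard_cast]; omega)
  have h2 := hp.deg_le_two G w
  have hxw := hx.2 w
  rw [Function.update_self] at hxw
  obtain ⟨x', hx', hc⟩ := apply_good G (r := t + 2) hx hy hp.1 hp.2.1 (fun v => by
    have := (hp.2.2 v).2
    rwa [zDeg_sub, zDeg_cast, zDeg_cast] at this) (by push_cast; omega)
  have := mu_le_of G hx'
  omega

theorem mu_aug2 (b : V → ℕ) (w : V) (t s r : ℕ) (h : mu G b w t + 2 ≤ mu G b w s)
    (hr : s + t ≤ 2 * r + 1) (htr : t ≤ r) :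
    mu G b w t + 1 ≤ mu G b w r := by
  obtain ⟨x, hx, hxc⟩ := mu_attained G b w t
  obtain ⟨y, hy, hyc⟩ := mu_attained G b w s
  obtain ⟨p, hp⟩ := exists_good G _ ((fun e => (y e : ℤ)) - (fun e => (x e : ℤ))) rfl (by
    rw [zCard_sub, zCard_cast, zCard_cast]; omega)
  obtain ⟨q, hq⟩ := exists_good G _ ((fun e => (y e : ℤ)) - (fun e => (x e : ℤ)) - p) rfl (by
    rw [zCard_sub, zCard_sub, zCard_cast, zCard_cast, hp.2.1]; omega)
  have hpD : ∀ v, zDeg G p v ≤ max ((bmDeg G y v : ℤ) - bmDeg G x v) 0 := fun v => by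
    have := (hp.2.2 v).2
    rwa [zDeg_sub, zDeg_cast, zDeg_cast] at this
  have hqD : ∀ v, zDeg G q v ≤ max ((bmDeg G y v : ℤ) - bmDeg G x v - zDeg G p v) 0 := fun v => by
    have := (hq.2.2 v).2
    rwa [zDeg_sub, zDeg_sub, zDeg_cast, zDeg_cast] at this
  have hxw := hx.2 w
  have hyw := hy.2 w
  rw [Function.update_self] at hxw hyw
  have hp0 := fun v => (hp.2.2 v).1
  have hpw := hpD w
  have hqw := hqD w
  have hp0w := hp0 w
  have hp2 := hp.deg_le_two G w
  by_cases hc : (bmDeg G x w : ℤ) + zDeg G p w ≤ r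
  · obtain ⟨x', hx', hc⟩ := apply_good G (r := r) hx hy hp.1 hp.2.1 hpD hc
    have := mu_le_of G hx'
    omega
  · obtain ⟨x', hx', hc⟩ := apply_good G (r := r) hx hy (hp.1.trans_sub hq.1) hq.2.1
      (fun v => by have := hp0 v; have := hqD v; omega) (by omega)
    have := mu_le_of G hx'
    omega

end helpers

theorem seq_lemma (f : ℕ → ℕ) (B : ℕ) (hB : ∀ t, f t ≤ B) (h0 : ∀ t, f t ≤ f (t + 1))
    (h1 : ∀ t, f (t + 1) ≤ f t + 1)
    (hA : ∀ t, f t + 2 ≤ f (t + 3) → f t + 1 ≤ f (t + 1))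
    (hC : ∀ t, f t < f (t + 3) → f t + 1 ≤ f (t + 2)) :
    ∃ c₁ c₂ : ℕ, ∀ t : ℕ,
      (t ≤ c₁ → f t = f 0 + t) ∧
      (c₁ < t → t ≤ c₁ + 2 * c₂ → f t = f 0 + c₁ + (t - c₁) / 2) ∧
      (c₁ + 2 * c₂ < t → f t = f 0 + c₁ + c₂) := by
  have e1 : ∃ t, f (t + 1) = f t := by
    by_contra! hne
    have : ∀ t, f t = f 0 + t := by
      intro t
      induction t with
      | zero => rfl
      | succ k ih => have := hne k; have := h0 k; have := h1 k; omega
    have := this (B + 1); have := hB (B + 1); omega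
  let c₁ := Nat.find e1
  have hc1 : f (c₁ + 1) = f c₁ := Nat.find_spec e1
  have hlt1 : ∀ t, t < c₁ → f (t + 1) ≠ f t := fun t ht => Nat.find_min e1 ht
  have a1 : ∀ t, t ≤ c₁ → f t = f 0 + t := by
    intro t
    induction t with
    | zero => intro _; rfl
    | succ k ih =>
      intro hk
      have := ih (by omega); have := hlt1 k (by omega); have := h0 k; have := h1 k; omega
  have e2 : ∃ k, f (c₁ + 2 * k + 2) = f (c₁ + 2 * k) := by
    by_contra! hne
    have : ∀ k, f 0 + k ≤ f (c₁ + 2 * k) := by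
      intro k
      induction k with
      | zero => have := a1 c₁ le_rfl; simp; omega
      | succ k ih =>
        have := hne k; have := h0 (c₁ + 2 * k); have := h0 (c₁ + 2 * k + 1)
        rw [show c₁ + 2 * (k + 1) = c₁ + 2 * k + 2 by ring]
        rw [show c₁ + 2 * k + 1 + 1 = c₁ + 2 * k + 2 by ring] at *
        omega
    have := this (B + 1); have := hB (c₁ + 2 * (B + 1)); omega
  let c₂ := Nat.find e2
  have hc2 : f (c₁ + 2 * c₂ + 2) = f (c₁ + 2 * c₂) := Nat.find_spec e2
  have hlt2 : ∀ k, k < c₂ → f (c₁ + 2 * k + 2) ≠ f (c₁ + 2 * k) := fun t ht => Nat.find_min e2 ht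
  have a2 : ∀ k, k ≤ c₂ → f (c₁ + 2 * k) = f 0 + c₁ + k ∧ f (c₁ + 2 * k + 1) = f 0 + c₁ + k := by
    intro k
    induction k with
    | zero => intro _; have := a1 c₁ le_rfl; simp; omega
    | succ k ih =>
      intro hk
      have i1 := ih (by omega)
      have i2 := hlt2 k (by omega)
      have i3 := h0 (c₁ + 2 * k + 1)
      have i4 := h1 (c₁ + 2 * k + 1)
      have i5 := hA (c₁ + 2 * k)
      have i6 := h0 (c₁ + 2 * k + 2)
      rw [show c₁ + 2 * (k + 1) = c₁ + 2 * k + 2 by ring]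
      simp only [add_assoc, Nat.reduceAdd] at *
      omega
  have a3 : ∀ j, f (c₁ + 2 * c₂ + j) = f 0 + c₁ + c₂ ∧ f (c₁ + 2 * c₂ + j + 1) = f 0 + c₁ + c₂ ∧
      f (c₁ + 2 * c₂ + j + 2) = f 0 + c₁ + c₂ := by
    intro j
    induction j with
    | zero => have := a2 c₂ le_rfl; simp only [add_zero]; omega
    | succ j ih =>
      have i1 := hC (c₁ + 2 * c₂ + j)
      have i2 := h0 (c₁ + 2 * c₂ + j + 2)
      simp only [add_assoc, Nat.reduceAdd, Nat.add_comm 1] at *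
      omega
  refine ⟨c₁, c₂, fun t => ⟨a1 t, fun ht1 ht2 => ?_, fun ht => ?_⟩⟩
  · have i := a2 ((t - c₁) / 2) (by omega)
    rcases Nat.mod_two_eq_zero_or_one (t - c₁) with hm | hm
    · rw [show c₁ + 2 * ((t - c₁) / 2) = t by omega] at i
      exact i.1
    · rw [show c₁ + 2 * ((t - c₁) / 2) + 1 = t by omega] at i
      exact i.2
  · have i := (a3 (t - (c₁ + 2 * c₂))).1
    rwa [show c₁ + 2 * c₂ + (t - (c₁ + 2 * c₂)) = t by omega] at i

/-- The function `μ` is piecewise linear: there exist `c₁, c₂` such that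
`μ(t) = μ(0) + t` for `t ≤ c₁`, `μ(t) = μ(0) + c₁ + ⌊(t − c₁)/2⌋` for
`c₁ < t ≤ c₁ + 2c₂`, and `μ(t) = μ(0) + c₁ + c₂` for `t > c₁ + 2c₂`. -/
theorem mu_piecewise_linear {V : Type*} [Fintype V] (G : SimpleGraph V) (b : V → ℕ)
    (w : V) :
    ∃ c₁ c₂ : ℕ, ∀ t : ℕ,
      (t ≤ c₁ → mu G b w t = mu G b w 0 + t) ∧
      (c₁ < t → t ≤ c₁ + 2 * c₂ → mu G b w t = mu G b w 0 + c₁ + (t - c₁) / 2) ∧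
      (c₁ + 2 * c₂ < t → mu G b w t = mu G b w 0 + c₁ + c₂) := by
  refine seq_lemma (mu G b w) (∑ v ∈ Finset.univ.erase w, b v) (fun t => ?_) (mu_mono G b w)
    (fun t => ?_) (fun t h => mu_aug2 G b w t (t + 3) (t + 1) h (by omega) (by omega))
    (fun t h => mu_aug1 G b w t (t + 3) h)
  · obtain ⟨x, hx, h⟩ := mu_attained G b w t
    rw [← h]
    exact bm_bound G hx
  · by_contra hh
    have := mu_aug2 G b w t (t + 1) t (by omega) (by omega) le_rfl
    omega
end

section
/- Let t_max be the least natural number t₀ such that μ(t) = μ(t₀) for all t ≥ t₀, and let c₁ be the largest natural number t such that μ(t) = μ(0) + t (both are well-defined since μ is nondecreasing, μ(t) ≤ μ(0) + t, and μ is eventually constant). Then t_max ≥ c₁ and t_max − c₁ is even. -/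
open scoped Classical

namespace BMAux

/-- Signed degree. -/
noncomputable def sdeg {V : Type*} [Fintype V] (G : SimpleGraph V)
    (D : Sym2 V → ℤ) (v : V) : ℤ :=
  ∑ e ∈ Finset.univ.filter (fun e : Sym2 V => e ∈ G.edgeSet ∧ v ∈ e), D e

/-- `a` lies between `0` and `c`. -/
def Btw (a c : ℤ) : Prop := (0 ≤ a ∧ a ≤ c) ∨ (c ≤ a ∧ a ≤ 0)

lemma sdeg_add {V : Type*} [Fintype V] (G : SimpleGraph V) (D E : Sym2 V → ℤ) (v : V) :
    sdeg G (D + E) v = sdeg G D v + sdeg G E v := by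
  simp [sdeg, Finset.sum_add_distrib]

lemma sdeg_neg {V : Type*} [Fintype V] (G : SimpleGraph V) (D : Sym2 V → ℤ) (v : V) :
    sdeg G (-D) v = - sdeg G D v := by
  simp [sdeg]

lemma sdeg_sub {V : Type*} [Fintype V] (G : SimpleGraph V) (D E : Sym2 V → ℤ) (v : V) :
    sdeg G (D - E) v = sdeg G D v - sdeg G E v := by
  simp [sdeg]

lemma sdeg_single {V : Type*} [Fintype V] (G : SimpleGraph V) (u v a : V) (h : G.Adj u v) :
    sdeg G (Pi.single s(u,v) 1) a = (if a = u then 1 else 0) + (if a = v then 1 else 0) := by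
  have huv : u ≠ v := h.ne
  unfold sdeg
  rw [Finset.sum_pi_single']
  simp only [Finset.mem_filter, Finset.mem_univ, true_and, SimpleGraph.mem_edgeSet, h, Sym2.mem_iff]
  by_cases h1 : a = u
  · subst h1; simp [huv]
  · simp [h1]

lemma walk {V : Type*} [Fintype V] (G : SimpleGraph V) (n : ℕ) :
    ∀ (D : Sym2 V → ℤ) (u : V), (∑ e, (D e).natAbs) ≤ n → 1 ≤ sdeg G D u →
    ∃ (D' : Sym2 V → ℤ) (v : V) (ε : ℤ), (∀ e, Btw (D' e) (D e)) ∧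
      (∀ e, e ∉ G.edgeSet → D' e = 0) ∧
      (∀ a, Btw (sdeg G D' a) (sdeg G D a)) ∧ (ε = 1 ∨ ε = -1) ∧ 1 ≤ sdeg G D' u ∧
      ∀ a, sdeg G D' a = (if a = u then 1 else 0) + (if a = v then ε else 0) := by
  induction n with
  | zero =>
    intro D u hn h
    exfalso
    have : ∀ e, D e = 0 := by simpa using hn
    simp [sdeg, this] at h
  | succ n ih =>
    intro D u hn h
    obtain ⟨e, he, hpos⟩ : ∃ e ∈ Finset.univ.filter (fun e : Sym2 V => e ∈ G.edgeSet ∧ u ∈ e),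
        0 < D e := by
      by_contra! hc
      have := Finset.sum_nonpos hc
      unfold sdeg at h
      omega
    simp only [Finset.mem_filter, Finset.mem_univ, true_and] at he
    obtain ⟨heG, hue⟩ := he
    obtain ⟨v, rfl⟩ := Sym2.mem_iff_exists.mp hue
    have hadj : G.Adj u v := by simpa using heG
    have huv : u ≠ v := hadj.ne
    have hs := fun a => sdeg_single G u v a hadj
    by_cases hv : 1 ≤ sdeg G D v
    · refine ⟨Pi.single s(u,v) 1, v, 1, ?_, ?_, ?_, Or.inl rfl, ?_, hs⟩
      · intro e
        by_cases h1 : e = s(u,v)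
        · subst h1; simp [Btw]; omega
        · simp [Btw, h1]; omega
      · intro e h1
        have : e ≠ s(u,v) := by rintro rfl; exact h1 heG
        simp [this]
      · intro a
        rw [hs]
        by_cases h1 : a = u
        · subst h1; simp [huv, Btw]; omega
        · by_cases h2 : a = v
          · subst h2; simp [h1, Btw]; omega
          · simp [h1, h2, Btw]; omega
      · rw [hs]; simp [huv]
    · have h1 : (∑ e, ((-(D - Pi.single s(u,v) 1) : Sym2 V → ℤ) e).natAbs) ≤ n := by
        have : (∑ e, ((-(D - Pi.single s(u,v) 1) : Sym2 V → ℤ) e).natAbs) < ∑ e, (D e).natAbs := by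
          apply Finset.sum_lt_sum
          · intro e _
            by_cases h1 : e = s(u,v)
            · subst h1; simp; omega
            · simp [h1]
          · refine ⟨s(u,v), Finset.mem_univ _, ?_⟩
            simp; omega
        omega
      have h2 : ∀ a, sdeg G (-(D - Pi.single s(u,v) 1)) a =
          - sdeg G D a + ((if a = u then 1 else 0) + (if a = v then 1 else 0)) := by
        intro a; rw [sdeg_neg, sdeg_sub, hs]; ring
      obtain ⟨F, z, ε, hF1, hF0, hF2, hε, hF3, hF4⟩ := ih _ v h1 (by
        rw [h2]; simp [huv.symm]; omega)
      have h3 : ∀ a, sdeg G (Pi.single s(u,v) 1 - F) a =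
          ((if a = u then 1 else 0) + (if a = v then 1 else 0)) - sdeg G F a := by
        intro a; rw [sdeg_sub, hs]
      have h4 : ∀ a, Btw (sdeg G (Pi.single s(u,v) 1 - F) a) (sdeg G D a) := by
        intro a
        have := hF2 a
        rw [h2] at this
        rw [h3]
        unfold Btw at *
        by_cases k1 : a = u
        · have k2 : a ≠ v := fun h => huv (k1.symm.trans h)
          rw [if_pos k1, if_neg k2] at this ⊢
          rw [k1] at this ⊢
          omega
        · by_cases k2 : a = v
          · rw [if_neg k1, if_pos k2] at this ⊢
            rw [k2] at this ⊢
            omega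
          · rw [if_neg k1, if_neg k2] at this ⊢
            omega
      refine ⟨Pi.single s(u,v) 1 - F, z, -ε, ?_, ?_, h4, by omega, ?_, ?_⟩
      · intro e
        have := hF1 e
        unfold Btw at *
        by_cases h1 : e = s(u,v)
        · subst h1; simp at *; omega
        · simp [h1] at *; omega
      · intro e h1
        have : e ≠ s(u,v) := by rintro rfl; exact h1 heG
        simp [this, hF0 e h1]
      · have := hF2 u
        rw [h2] at this
        rw [h3]
        unfold Btw at this
        simp only [huv, if_true, if_false] at *; omega
      · intro a
        rw [h3, hF4]
        split_ifs <;> ring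

lemma cast_deg {V : Type*} [Fintype V] (G : SimpleGraph V) (x : Sym2 V → ℕ) (v : V) :
    (bmDeg G x v : ℤ) = sdeg G (fun e => (x e : ℤ)) v := by
  simp [bmDeg, sdeg]

lemma bdd {V : Type*} [Fintype V] (G : SimpleGraph V) (b : V → ℕ) :
    BddAbove {m | ∃ x, IsBMatching G b x ∧ bmCard G x = m} := by
  refine ⟨∑ _e : Sym2 V, ∑ v, b v, ?_⟩
  rintro m ⟨x, hx, rfl⟩
  unfold bmCard
  refine le_trans (Finset.sum_le_sum_of_subset (Finset.subset_univ _)) ?_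
  apply Finset.sum_le_sum
  intro e _
  by_cases he : e ∈ G.edgeSet
  · induction e with
    | h u v =>
      calc x s(u,v) ≤ bmDeg G x u := by
            unfold bmDeg
            exact Finset.single_le_sum (f := x) (fun _ _ => Nat.zero_le _) (by simpa using he)
        _ ≤ b u := hx.2 u
        _ ≤ ∑ v, b v := Finset.single_le_sum (f := b) (fun _ _ => Nat.zero_le _) (Finset.mem_univ u)
  · rw [hx.1 e he]; exact Nat.zero_le _

lemma le_mu {V : Type*} [Fintype V] (G : SimpleGraph V) (b : V → ℕ) (w : V) (t : ℕ)
    (x : Sym2 V → ℕ) (h0 : ∀ e, e ∉ G.edgeSet → x e = 0) (h1 : ∀ v, v ≠ w → bmDeg G x v ≤ b v)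
    (h2 : bmDeg G x w ≤ t) : bmCard G x ≤ mu G b w t := by
  refine le_csSup (bdd G _) ⟨x, ⟨h0, ?_⟩, rfl⟩
  intro v
  by_cases h : v = w
  · subst h; simpa using h2
  · simpa [h] using h1 v h

lemma exists_mu {V : Type*} [Fintype V] (G : SimpleGraph V) (b : V → ℕ) (w : V) (t : ℕ) :
    ∃ x : Sym2 V → ℕ, (∀ e, e ∉ G.edgeSet → x e = 0) ∧ (∀ v, v ≠ w → bmDeg G x v ≤ b v) ∧
      bmDeg G x w ≤ t ∧ bmCard G x = mu G b w t := by
  have : mu G b w t ∈ {m | ∃ x, IsBMatching G (Function.update b w t) x ∧ bmCard G x = m} := by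
    apply Nat.sSup_mem _ (bdd G _)
    exact ⟨_, fun _ => 0, ⟨fun _ _ => rfl, fun v => by simp [bmDeg]⟩, rfl⟩
  obtain ⟨x, hx, hc⟩ := this
  refine ⟨x, hx.1, ?_, ?_, hc⟩
  · intro v hv
    simpa [hv] using hx.2 v
  · simpa using hx.2 w

lemma mu_mono {V : Type*} [Fintype V] (G : SimpleGraph V) (b : V → ℕ) (w : V) (t : ℕ) :
    mu G b w t ≤ mu G b w (t+1) := by
  obtain ⟨x, h0, h1, h2, h3⟩ := exists_mu G b w t
  rw [← h3]
  exact le_mu G b w _ x h0 h1 (by omega)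

lemma mu_lip {V : Type*} [Fintype V] (G : SimpleGraph V) (b : V → ℕ) (w : V) (t : ℕ) :
    mu G b w (t+1) ≤ mu G b w t + 1 := by
  obtain ⟨x, h0, h1, h2, h3⟩ := exists_mu G b w (t+1)
  rw [← h3]
  by_cases h : bmDeg G x w ≤ t
  · have := le_mu G b w t x h0 h1 h
    omega
  · obtain ⟨e, he, hpos⟩ : ∃ e ∈ Finset.univ.filter (fun e : Sym2 V => e ∈ G.edgeSet ∧ w ∈ e),
        x e ≠ 0 := by
      apply Finset.exists_ne_zero_of_sum_ne_zero
      unfold bmDeg at h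
      omega
    simp only [Finset.mem_filter, Finset.mem_univ, true_and] at he
    have key : x = Function.update x e (x e - 1) + Pi.single e 1 := by
      funext f
      by_cases hf : f = e
      · subst hf; simp; omega
      · simp [hf]
    have hle : ∀ f, Function.update x e (x e - 1) f ≤ x f := by
      intro f
      by_cases hf : f = e
      · subst hf; simp
      · simp [hf]
    have hd : bmDeg G x w = bmDeg G (Function.update x e (x e - 1)) w + 1 := by
      conv_lhs => rw [key]
      simp [bmDeg, Finset.sum_add_distrib, he]
    have hcd : bmCard G x = bmCard G (Function.update x e (x e - 1)) + 1 := by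
      conv_lhs => rw [key]
      simp [bmCard, Finset.sum_add_distrib, he]
    have := le_mu G b w t (Function.update x e (x e - 1))
      (fun f hf => by have := hle f; have := h0 f hf; omega)
      (fun v hv => le_trans (Finset.sum_le_sum fun f _ => hle f) (h1 v hv))
      (by omega)
    omega

lemma mu_key {V : Type*} [Fintype V] (G : SimpleGraph V) (b : V → ℕ) (w : V) (t : ℕ) :
    mu G b w t + mu G b w (t+3) ≤ mu G b w (t+1) + mu G b w (t+2) := by
  obtain ⟨x, hx0, hx1, hx2, hx3⟩ := exists_mu G b w t
  obtain ⟨y, hy0, hy1, hy2, hy3⟩ := exists_mu G b w (t+3)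
  rw [← hx3, ← hy3]
  by_cases h : bmDeg G y w ≤ t + 2
  · have h1 := le_mu G b w (t+1) x hx0 hx1 (by omega)
    have h2 := le_mu G b w (t+2) y hy0 hy1 h
    omega
  set D : Sym2 V → ℤ := fun e => (y e : ℤ) - x e with hD
  have hdD : ∀ v, sdeg G D v = bmDeg G y v - bmDeg G x v := by
    intro v; rw [cast_deg, cast_deg, ← sdeg_sub]; rfl
  obtain ⟨F, z, ε, hF1, hF0, hF2, hε, hF3, hF4⟩ := walk G _ D w le_rfl (by rw [hdD]; omega)
  have hF5 : sdeg G F w ≤ 2 := by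
    rw [hF4]; split_ifs <;> omega
  have hx' : ∀ e, (((x e + F e).toNat : ℕ) : ℤ) = x e + F e := by
    intro e
    have := hF1 e
    simp only [Btw, hD] at this
    omega
  have hy' : ∀ e, (((y e - F e).toNat : ℕ) : ℤ) = y e - F e := by
    intro e
    have := hF1 e
    simp only [Btw, hD] at this
    omega
  have hdx : ∀ v, (bmDeg G (fun e => (x e + F e).toNat) v : ℤ) = bmDeg G x v + sdeg G F v := by
    intro v; rw [cast_deg, cast_deg, ← sdeg_add]; simp only [hx']; rfl
  have hdy : ∀ v, (bmDeg G (fun e => (y e - F e).toNat) v : ℤ) = bmDeg G y v - sdeg G F v := by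
    intro v; rw [cast_deg, cast_deg, ← sdeg_sub]; simp only [hy']; rfl
  have hc : bmCard G x + bmCard G y =
      bmCard G (fun e => (x e + F e).toNat) + bmCard G (fun e => (y e - F e).toNat) := by
    unfold bmCard
    rw [← Finset.sum_add_distrib, ← Finset.sum_add_distrib]
    apply Finset.sum_congr rfl
    intro e _
    have := hx' e
    have := hy' e
    omega
  have a0 : ∀ e, e ∉ G.edgeSet → (x e + F e).toNat = 0 := fun e he => by
    simp [hx0 e he, hF0 e he]
  have b0 : ∀ e, e ∉ G.edgeSet → (y e - F e).toNat = 0 := fun e he => by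
    simp [hy0 e he, hF0 e he]
  have a1 : ∀ v, v ≠ w → bmDeg G (fun e => (x e + F e).toNat) v ≤ b v := by
    intro v hv
    have h1 := hF2 v
    have h2 := hdx v
    have h3 := hx1 v hv
    have h4 := hy1 v hv
    rw [hdD] at h1
    unfold Btw at h1
    omega
  have b1 : ∀ v, v ≠ w → bmDeg G (fun e => (y e - F e).toNat) v ≤ b v := by
    intro v hv
    have h1 := hF2 v
    have h2 := hdy v
    have h3 := hx1 v hv
    have h4 := hy1 v hv
    rw [hdD] at h1
    unfold Btw at h1
    omega
  have h1 := hdx w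
  have h2 := hdy w
  rw [hc]
  by_cases h5 : sdeg G F w = 1
  · have := le_mu G b w (t+1) _ a0 a1 (by omega)
    have := le_mu G b w (t+2) _ b0 b1 (by omega)
    omega
  · have := le_mu G b w (t+2) _ a0 a1 (by omega)
    have := le_mu G b w (t+1) _ b0 b1 (by omega)
    omega

end BMAux


/-- Let `t_max` be the least `t₀` such that `μ(t) = μ(t₀)` for all `t ≥ t₀`, and
let `c₁` be the largest `t` such that `μ(t) = μ(0) + t`. Then `t_max ≥ c₁` and
`t_max − c₁` is even. -/
theorem tmax_sub_c1_even {V : Type*} [Fintype V] (G : SimpleGraph V) (b : V → ℕ)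
    (w : V) (tmax c₁ : ℕ)
    (htmax : ∀ t : ℕ, tmax ≤ t → mu G b w t = mu G b w tmax)
    (htmax_least : ∀ t₀ : ℕ, (∀ t : ℕ, t₀ ≤ t → mu G b w t = mu G b w t₀) → tmax ≤ t₀)
    (hc₁ : mu G b w c₁ = mu G b w 0 + c₁)
    (hc₁_max : ∀ t : ℕ, mu G b w t = mu G b w 0 + t → t ≤ c₁) :
    c₁ ≤ tmax ∧ Even (tmax - c₁) := by
  have mono := BMAux.mu_mono G b w
  have lip := BMAux.mu_lip G b w
  have key := BMAux.mu_key G b w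
  have lip0 : ∀ t, mu G b w t ≤ mu G b w 0 + t := by
    intro t
    induction t with
    | zero => omega
    | succ t ih => have := lip t; omega
  have hle : c₁ ≤ tmax := by
    by_contra hlt
    have h1 := htmax c₁ (by omega)
    have h2 := lip0 tmax
    omega
  refine ⟨hle, ?_⟩
  have hflat : ∀ k, mu G b w (c₁ + 2 * k + 1) = mu G b w (c₁ + 2 * k) := by
    intro k
    induction k with
    | zero =>
      have h1 := mono c₁
      have h2 := lip c₁
      have h3 : mu G b w (c₁ + 1) ≠ mu G b w 0 + (c₁ + 1) := by
        intro h
        have := hc₁_max _ h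
        omega
      simp only [Nat.mul_zero, Nat.add_zero]
      omega
    | succ k ih =>
      have h1 := key (c₁ + 2 * k)
      have h2 := mono (c₁ + 2 * k + 2)
      have e1 : c₁ + 2 * (k + 1) = c₁ + 2 * k + 2 := by ring
      rw [e1]
      have e2 : c₁ + 2 * k + 2 + 1 = c₁ + 2 * k + 3 := by ring
      rw [e2] at h2 ⊢
      omega
  by_contra hodd
  rw [Nat.not_even_iff_odd] at hodd
  obtain ⟨k, hk⟩ := hodd
  have ht : tmax = c₁ + 2 * k + 1 := by omega
  have h1 := hflat k
  rw [← ht] at h1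
  have := htmax_least (c₁ + 2 * k) (by
    intro t h
    rcases Nat.eq_or_lt_of_le h with h | h
    · rw [h]
    · rw [htmax t (by omega), h1])
  omega
end

section
/- Let (U,W) be a split of G and let x be a b-matching of (G,b). Define b^U on G_U by b^U_v = b(v) for v ∈ U and b^U_w = Σ_{v∈C, v'∈D} x_{{v,v'}}, and define x^U on the edges of G_U by x^U_e = x_e for every edge e with both ends in U, and x^U_{{v,w}} = Σ_{v'∈D} x_{{v,v'}} for every v ∈ C. Then x^U is a b-matching of (G_U, b^U), deg_{x^U}(w) = b^U_w, and ‖x^U‖₁ = Σ_{e with both ends in U} x_e + Σ_{v∈C, v'∈D} x_{{v,v'}}. -/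
open scoped Classical

/-- `(U, W)` is a split of `G`: a partition of the vertex set with both sides
of size at least `2`, such that every vertex of `U` having a neighbour in `W`
is adjacent to every vertex of `W` having a neighbour in `U`. -/
def IsSplit {V : Type*} (G : SimpleGraph V) (U W : Set V) : Prop :=
  U ∪ W = Set.univ ∧ Disjoint U W ∧ 2 ≤ U.ncard ∧ 2 ≤ W.ncard ∧
    ∀ a ∈ U, ∀ c ∈ W, (∃ b' ∈ W, G.Adj a b') → (∃ a' ∈ U, G.Adj a' c) → G.Adj a c

/-- `splitC G U W` is the set of vertices of `U` with a neighbour in `W`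
(so `splitC G U W = C = N_G(W)` and `splitC G W U = D = N_G(U)`). -/
def splitC {V : Type*} (G : SimpleGraph V) (U W : Set V) : Set V :=
  {a | a ∈ U ∧ ∃ c ∈ W, G.Adj a c}

/-- Given a split `(U, W)` (with `C = N_G(W)`), the graph `G_U` on `U ∪ {w}`:
the induced subgraph `G[U]` together with a new split marker vertex `w`
(represented by `none`) adjacent to every vertex of `C`. -/
def sideGraph {V : Type*} (G : SimpleGraph V) (U C : Set V) :
    SimpleGraph (Option ↥U) :=
  SimpleGraph.fromRel (fun a c =>
    match a, c with
    | some a', some c' => G.Adj ↑a' ↑c'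
    | some a', none => ↑a' ∈ C
    | _, _ => False)

/-- The partial solution `x^U` on the edges of `G_U` induced by a `b`-matching
`x` of `G`: edges inside `U` keep their weight, and the weight of the edge
from `v ∈ C` to the marker `w` is `Σ_{v' ∈ D} x {v, v'}`. -/
noncomputable def inducedXU {V : Type*} [Fintype V] (U D : Set V) (x : Sym2 V → ℕ) :
    Sym2 (Option ↥U) → ℕ :=
  Sym2.lift ⟨fun a c =>
    match a, c with
    | some a', some c' => x s(↑a', ↑c')
    | some a', none => ∑ v' ∈ D.toFinset, x s(↑a', v')
    | none, some c' => ∑ v' ∈ D.toFinset, x s(↑c', v')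
    | none, none => 0,
    by
      rintro (_ | a) (_ | c)
      · rfl
      · rfl
      · rfl
      · show x s(↑a, ↑c) = x s(↑c, ↑a)
        rw [Sym2.eq_swap]⟩

/-- The capacity function `b^U` on `G_U`: `b^U v = b v` for `v ∈ U`, and the
marker `w` gets capacity `Σ_{v ∈ C, v' ∈ D} x {v, v'}`. -/
noncomputable def inducedBU {V : Type*} [Fintype V] (C D : Set V) (U : Set V)
    (b : V → ℕ) (x : Sym2 V → ℕ) : Option ↥U → ℕ :=
  fun a => a.elim (∑ v ∈ C.toFinset, ∑ v' ∈ D.toFinset, x s(v, v')) (fun a' => b ↑a')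

lemma bmDeg_eq_sum {V : Type*} [Fintype V] (G : SimpleGraph V)
    (x : Sym2 V → ℕ) (hx : ∀ e, e ∉ G.edgeSet → x e = 0) (v : V) :
    bmDeg G x v = ∑ u, x s(v, u) := by
  have h1 : bmDeg G x v = ∑ e ∈ Finset.univ.filter (fun e : Sym2 V => v ∈ e), x e := by
    unfold bmDeg
    apply Finset.sum_subset
    · intro e he
      simp only [Finset.mem_filter, Finset.mem_univ, true_and] at he ⊢
      exact he.2
    · intro e he he'
      simp only [Finset.mem_filter, Finset.mem_univ, true_and] at he he'
      exact hx e fun h => he' ⟨h, he⟩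
  rw [h1]
  symm
  refine Finset.sum_bij (fun u _ => s(v, u)) ?_ ?_ ?_ ?_
  · intro u _
    simp
  · intro a _ c _ h
    exact Sym2.congr_right.1 h
  · intro e he
    simp only [Finset.mem_filter, Finset.mem_univ, true_and] at he
    obtain ⟨u, rfl⟩ := he
    exact ⟨u, Finset.mem_univ _, rfl⟩
  · intros
    rfl

lemma sideGraph_adj_some {V : Type*} (G : SimpleGraph V) (U C : Set V) (a c : U) :
    (sideGraph G U C).Adj (some a) (some c) ↔ G.Adj a c := by
  simp only [sideGraph, SimpleGraph.fromRel_adj]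
  constructor
  · rintro ⟨_, h | h⟩
    · exact h
    · exact h.symm
  · intro h
    refine ⟨?_, Or.inl h⟩
    intro e
    cases e
    exact G.loopless.irrefl _ h

lemma sideGraph_adj_none {V : Type*} (G : SimpleGraph V) (U C : Set V) (a : U) :
    (sideGraph G U C).Adj (some a) none ↔ (a : V) ∈ C := by
  simp [sideGraph, SimpleGraph.fromRel_adj]

lemma inducedXU_support {V : Type*} [Fintype V] (G : SimpleGraph V) (U W : Set V)
    (x : Sym2 V → ℕ) (hx : ∀ e, e ∉ G.edgeSet → x e = 0) :
    ∀ e, e ∉ (sideGraph G U (splitC G U W)).edgeSet →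
      inducedXU U (splitC G W U) x e = 0 := by
  have key : ∀ a : U, (a : V) ∉ splitC G U W →
      ∑ v' ∈ (splitC G W U).toFinset, x s((a : V), v') = 0 := by
    intro a ha
    apply Finset.sum_eq_zero
    intro v' hv'
    apply hx
    intro h
    rw [Set.mem_toFinset] at hv'
    exact ha ⟨a.2, v', hv'.1, h⟩
  intro e
  induction e using Sym2.ind with
  | _ a c =>
    intro h
    rw [SimpleGraph.mem_edgeSet] at h
    rcases a with _ | a <;> rcases c with _ | c
    · rfl
    · rw [SimpleGraph.adj_comm, sideGraph_adj_none] at h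
      exact key c h
    · rw [sideGraph_adj_none] at h
      exact key a h
    · rw [sideGraph_adj_some] at h
      exact hx _ h

/-- Let `(U, W)` be a split of `G` (with `C = N_G(W)` and `D = N_G(U)`) and let
`x` be a `b`-matching of `(G, b)`. Then `x^U` is a `b`-matching of `(G_U, b^U)`,
the marker `w` is saturated (`deg_{x^U}(w) = b^U_w = Σ_{v ∈ C, v' ∈ D} x {v,v'}`),
and `‖x^U‖₁ = Σ_{e ⊆ U} x_e + Σ_{v ∈ C, v' ∈ D} x {v, v'}`. -/
theorem induced_bmatching_on_side {V : Type*} [Fintype V] (G : SimpleGraph V)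
    (hG : G.Connected) (b : V → ℕ) (U W : Set V) (hsplit : IsSplit G U W)
    (x : Sym2 V → ℕ) (hx : IsBMatching G b x) :
    IsBMatching (sideGraph G U (splitC G U W))
        (inducedBU (splitC G U W) (splitC G W U) U b x)
        (inducedXU U (splitC G W U) x) ∧
    bmDeg (sideGraph G U (splitC G U W)) (inducedXU U (splitC G W U) x) none =
      ∑ v ∈ (splitC G U W).toFinset, ∑ v' ∈ (splitC G W U).toFinset, x s(v, v') ∧
    bmCard (sideGraph G U (splitC G U W)) (inducedXU U (splitC G W U) x) =
      (∑ e ∈ Finset.univ.filter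
          (fun e : Sym2 V => e ∈ G.edgeSet ∧ ∀ v ∈ e, v ∈ U), x e) +
        ∑ v ∈ (splitC G U W).toFinset, ∑ v' ∈ (splitC G W U).toFinset, x s(v, v') := by
  obtain ⟨hx0, hxb⟩ := hx
  obtain ⟨hun, hdis, -, -, -⟩ := hsplit
  have hsup := inducedXU_support G U W x hx0
  have hnone : bmDeg (sideGraph G U (splitC G U W)) (inducedXU U (splitC G W U) x) none =
      ∑ v ∈ (splitC G U W).toFinset, ∑ v' ∈ (splitC G W U).toFinset, x s(v, v') := by
    rw [bmDeg_eq_sum _ _ hsup, Fintype.sum_option]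
    have h0 : inducedXU U (splitC G W U) x s(none, none) = 0 := rfl
    have h1 : ∀ c : U, inducedXU U (splitC G W U) x s(none, some c) =
      ∑ v' ∈ (splitC G W U).toFinset, x s((c : V), v') := fun _ => rfl
    rw [h0, zero_add]
    simp only [h1]
    rw [← Finset.sum_subtype U.toFinset (fun v => Set.mem_toFinset)
      (fun c => ∑ v' ∈ (splitC G W U).toFinset, x s(c, v'))]
    symm
    apply Finset.sum_subset
    · intro v hv
      rw [Set.mem_toFinset] at hv ⊢
      exact hv.1
    · intro v hv hv'
      rw [Set.mem_toFinset] at hv hv'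
      apply Finset.sum_eq_zero
      intro v' hd
      rw [Set.mem_toFinset] at hd
      exact hx0 _ fun h => hv' ⟨hv, v', hd.1, h⟩
  refine ⟨⟨hsup, ?_⟩, hnone, ?_⟩
  · rintro (_ | a)
    · exact hnone.le
    · refine le_trans ?_ (hxb a)
      rw [bmDeg_eq_sum _ _ hsup, bmDeg_eq_sum _ _ hx0, Fintype.sum_option]
      have h0 : inducedXU U (splitC G W U) x s(some a, none) =
        ∑ v' ∈ (splitC G W U).toFinset, x s((a : V), v') := rfl
      have h1 : ∀ c : U, inducedXU U (splitC G W U) x s(some a, some c) =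
        x s((a : V), (c : V)) := fun _ => rfl
      rw [h0]
      simp only [h1]
      rw [← Finset.sum_subtype U.toFinset (fun v => Set.mem_toFinset)
        (fun c => x s((a : V), c)), ← Finset.sum_union]
      · exact Finset.sum_le_sum_of_subset (Finset.subset_univ _)
      · rw [Finset.disjoint_left]
        intro v hv hv'
        rw [Set.mem_toFinset] at hv hv'
        exact Set.disjoint_left.1 hdis hv' hv.1
  · rw [← hnone]
    unfold bmCard bmDeg
    rw [← Finset.sum_filter_add_sum_filter_not _ (fun e => none ∈ e), add_comm,
      Finset.filter_filter, Finset.filter_filter]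
    refine congrArg₂ _ ?_ (by congr!)
    refine Finset.sum_bij' (fun e _ => e.map (fun o => o.elim hG.nonempty.some Subtype.val))
      (fun e _ => e.map (fun v => if h : v ∈ U then some ⟨v, h⟩ else none)) ?_ ?_ ?_ ?_ ?_
    all_goals intro e; induction e using Sym2.ind with | _ a c => ?_
    · rcases a with _ | a <;> rcases c with _ | c <;> simp [sideGraph_adj_some]
    · simp only [Finset.mem_filter, Finset.mem_univ, true_and, Sym2.map_mk, Sym2.mem_iff,
        SimpleGraph.mem_edgeSet]
      rintro ⟨h, hU⟩
      have ha := hU a (Or.inl rfl)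
      have hc := hU c (Or.inr rfl)
      simp [ha, hc, sideGraph_adj_some, h]
    · rcases a with _ | a <;> rcases c with _ | c <;> simp
    · simp only [Finset.mem_filter, Finset.mem_univ, true_and, Sym2.map_mk, Sym2.mem_iff,
        SimpleGraph.mem_edgeSet]
      rintro ⟨h, hU⟩
      have ha := hU a (Or.inl rfl)
      have hc := hU c (Or.inr rfl)
      simp [ha, hc]
    · rcases a with _ | a <;> rcases c with _ | c <;> simp [inducedXU]
end
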